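/- arXiv:1910.03764 — 3 statements merged into one kernel-verified Lean document; each statement's English description precedes it below -/
import Mathlib

section
/- Let m be a positive even integer and let A be an m×m matrix over k which is symmetric and has all diagonal entries equal to zero. If det A = 0, then the solution space X = {x ∈ k^m : A·x = 0} has dimension at least 2 over k. -/
open Matrix

/-- The rank of an alternating bilinear form is even: the dimension of the space and of the
radical have the same parity. -/
theorem LinearMap.BilinForm.IsAlt.even_finrank_add_finrank_ker {K V : Type*} [Field K]
    [AddCommGroup V] [Module K V] [FiniteDimensional K V] {B : LinearMap.BilinForm K V}
    (hB : B.IsAlt) : Even (Module.finrank K V + Module.finrank K (LinearMap.ker B)) := by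
  induction hn : Module.finrank K V using Nat.strong_induction_on generalizing V with
  | _ n ih =>
    by_cases h0 : B = 0
    · subst h0
      rw [LinearMap.ker_zero, finrank_top, hn]
      exact ⟨n, rfl⟩
    obtain ⟨x, y, hxy⟩ : ∃ x y, B x y ≠ 0 := by
      by_contra! h
      exact h0 (LinearMap.ext₂ h)
    have hyx : B y x = -B x y := (hB.neg_eq x y).symm
    let f : V →ₗ[K] K × K := (B x).prod (B y)
    have hf : LinearMap.range f = ⊤ := by
      rw [LinearMap.range_eq_top]
      rintro ⟨a, b⟩
      refine ⟨(a / B x y) • y - (b / B x y) • x, Prod.ext ?_ ?_⟩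
      · simp [f, hB.self_eq_zero, hxy]
      · simp [f, hB.self_eq_zero, hyx, hxy]
    have hdim := f.finrank_range_add_finrank_ker
    rw [hf, finrank_top, Module.finrank_prod, Module.finrank_self, hn] at hdim
    have hres : (B.restrict (LinearMap.ker f)).IsAlt := fun u => hB u
    have hker : (LinearMap.ker (B.restrict (LinearMap.ker f))).map (LinearMap.ker f).subtype =
        LinearMap.ker B := by
      ext u
      constructor
      · rintro ⟨⟨u, hu⟩, huker, rfl⟩
        have hux : B x u = 0 := congrArg Prod.fst hu
        have huy : B y u = 0 := congrArg Prod.snd hu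
        have hxu : B u x = 0 := by rw [← hB.neg_eq, hux, neg_zero]
        have hyu : B u y = 0 := by rw [← hB.neg_eq, huy, neg_zero]
        refine LinearMap.ext fun v => ?_
        have hv : v - (B v y / B x y) • x - (B x v / B x y) • y ∈ LinearMap.ker f := by
          refine Prod.ext ?_ ?_
          · simp [f, hB.self_eq_zero, hxy]
          · simp [f, hB.self_eq_zero, hyx, hxy, ← hB.neg_eq v y]
        have := LinearMap.congr_fun huker ⟨_, hv⟩
        simpa [hxu, hyu] using this
      · intro hu
        have hBu : ∀ v, B u v = 0 := fun v => LinearMap.congr_fun hu v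
        have hBu' : ∀ v, B v u = 0 := fun v => by rw [← hB.neg_eq, hBu, neg_zero]
        exact ⟨⟨u, Prod.ext (hBu' x) (hBu' y)⟩, LinearMap.ext fun v => hBu v, rfl⟩
    have hrec := ih _ (by omega) hres rfl
    rw [← Submodule.finrank_map_subtype_eq, hker] at hrec
    rw [← hdim]
    grind

/-- In characteristic two, a symmetric matrix with zero diagonal defines an alternating form. -/
theorem Matrix.IsSymm.isAlt_toBilin' {K n : Type*} [CommRing K] [CharP K 2] [Fintype n]
    [DecidableEq n] {A : Matrix n n K} (hsymm : A.IsSymm) (hdiag : ∀ a, A a a = 0) :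
    (Matrix.toBilin' A).IsAlt := by
  intro v
  rw [Matrix.toBilin'_apply, ← Fintype.sum_prod_type']
  refine Finset.sum_involution (fun p _ => p.swap) ?_ ?_ (by simp) (by simp)
  · rintro ⟨i, j⟩ -
    simp only [Prod.swap, hsymm.apply i j]
    rw [show v j * A i j * v i = v i * A i j * v j by ring]
    exact CharTwo.add_self_eq_zero _
  · rintro ⟨i, j⟩ - h he
    obtain rfl : j = i := congrArg Prod.fst he
    simp [hdiag] at h

/-- Over a field of characteristic 2, a symmetric matrix of even size with zero diagonal
and determinant zero has kernel of dimension at least 2. -/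
theorem even_symmetric_kernel_dim
    (K : Type) [Field K] [CharP K 2]
    (m : ℕ) (hm : 0 < m) (hme : Even m)
    (A : Matrix (Fin m) (Fin m) K)
    (hsymm : A.IsSymm) (hdiag : ∀ a, A a a = 0)
    (hdet : A.det = 0) :
    2 ≤ Module.finrank K (LinearMap.ker A.mulVecLin) := by
  have hAlt := hsymm.isAlt_toBilin' hdiag
  have hker : LinearMap.ker (Matrix.toBilin' A) = LinearMap.ker A.mulVecLin := by
    ext v
    simp only [LinearMap.mem_ker, Matrix.mulVecLin_apply]
    rw [LinearMap.ext_iff]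
    simp only [← hAlt.neg_eq _ v, Matrix.toBilin'_apply', LinearMap.zero_apply, neg_eq_zero]
    refine ⟨fun h => dotProduct_eq_zero _ fun w => ?_, fun h w => by rw [h, dotProduct_zero]⟩
    rw [dotProduct_comm, h]
  have heven := hAlt.even_finrank_add_finrank_ker
  rw [hker, Module.finrank_fin_fun] at heven
  have hpos : Module.finrank K (LinearMap.ker A.mulVecLin) ≠ 0 := by
    obtain ⟨v, hv, hAv⟩ := Matrix.exists_mulVec_eq_zero_iff.mpr hdet
    intro h
    rw [Submodule.finrank_eq_zero] at h
    exact hv ((Submodule.mem_bot K).mp (h ▸ hAv))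
  grind
end

section
/- Assume Γ = 2n, assume m_r is even for every r ∈ [1,N], and assume there exists σ ∈ [1,N] with k_σ odd and m_σ < 2n. Then det S = 0. -/
open Matrix

/-- The entries of the matrix `A_r` read with natural-number indices (zero outside range). -/
def Anat {K : Type} [Field K] {mr Γ : ℕ} (A : Matrix (Fin mr) (Fin Γ) K) (a b : ℕ) : K :=
  if ha : a < mr then (if hb : b < Γ then A ⟨a, ha⟩ ⟨b, hb⟩ else 0) else 0

/-- The block matrix `S`: the diagonal block at `(r,i)` is `[[0, A_r],[A_rᵀ, 0]]`, and the
off-diagonal block at `((r,i),(s,j))` is `[[0,0],[0, E^{r,s}_{i,j}]]` where the matrix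
`E^{r,s}_{i,j}` of size `Γ` is described by the entry function `EΓ (e r s i j) : ℕ → ℕ → K`. -/
def Smat (K : Type) [Field K] (N Γ : ℕ) (kk mm : Fin N → ℕ)
    (A : ∀ r : Fin N, Matrix (Fin (mm r)) (Fin Γ) K)
    (e : ∀ r s : Fin N, Fin (kk r) → Fin (kk s) → K)
    (EΓ : K → ℕ → ℕ → K) :
    Matrix (Σ r : Fin N, Fin (kk r) × Fin (mm r + Γ))
      (Σ r : Fin N, Fin (kk r) × Fin (mm r + Γ)) K :=
  Matrix.of fun x y =>
    if (⟨x.1, x.2.1⟩ : Σ r : Fin N, Fin (kk r)) = ⟨y.1, y.2.1⟩ then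
      (if (x.2.2 : ℕ) < mm x.1 ∧ mm y.1 ≤ (y.2.2 : ℕ) then
        Anat (A x.1) (x.2.2 : ℕ) ((y.2.2 : ℕ) - mm y.1)
      else if mm x.1 ≤ (x.2.2 : ℕ) ∧ (y.2.2 : ℕ) < mm y.1 then
        Anat (A y.1) (y.2.2 : ℕ) ((x.2.2 : ℕ) - mm x.1)
      else 0)
    else
      (if mm x.1 ≤ (x.2.2 : ℕ) ∧ mm y.1 ≤ (y.2.2 : ℕ) then
        EΓ (e x.1 y.1 x.2.1 y.2.1) ((x.2.2 : ℕ) - mm x.1) ((y.2.2 : ℕ) - mm y.1)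
      else 0)

/-- Entry function of the matrix `[[0, v·I_n],[v·I_n, 0]]` of size `2n`. -/
def Ent2n (K : Type) [Field K] (n : ℕ) (v : K) (a b : ℕ) : K :=
  if a + n = b ∨ b + n = a then v else 0

section AlternatingDet

variable {R ι : Type*} [CommRing R] [CharP R 2] [Fintype ι] [DecidableEq ι]

/-- In characteristic two, an alternating matrix of odd size has zero determinant. -/
lemma Matrix.det_eq_zero_of_symm_of_odd_card (M : Matrix ι ι R)
    (hsymm : ∀ i j, M i j = M j i) (hdiag : ∀ i, M i i = 0) (hodd : Odd (Fintype.card ι)) :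
    M.det = 0 := by
  have hsign : ∀ g : Equiv.Perm ι, ((Equiv.Perm.sign g : ℤ) : R) = 1 := fun g => by
    rcases Int.units_eq_one_or (Equiv.Perm.sign g) with h | h <;> simp [h, CharTwo.neg_eq]
  rw [Matrix.det_apply']
  simp only [hsign, one_mul]
  have hinv : ∀ g : Equiv.Perm ι, ∏ i, M (g⁻¹ i) i = ∏ i, M (g i) i := fun g => by
    rw [← Equiv.prod_comp g]
    exact Finset.prod_congr rfl fun i _ => by simp [hsymm i]
  refine Finset.sum_involution (fun g _ => g⁻¹) (fun g _ => ?_) (fun g _ hg hgg => hg ?_)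
    (fun _ _ => Finset.mem_univ _) (fun g _ => inv_inv g)
  · rw [hinv, CharTwo.add_self_eq_zero]
  · have hp : ¬ 2 ∣ Fintype.card ι := by
      rwa [← even_iff_two_dvd, Nat.not_even_iff_odd]
    have hg2 : g ^ 2 ^ 1 = 1 := by
      rw [pow_one, sq]
      nth_rewrite 1 [← hgg]
      exact inv_mul_cancel g
    obtain ⟨i, hi⟩ := Equiv.Perm.exists_fixed_point_of_prime (p := 2) hp hg2
    exact Finset.prod_eq_zero (Finset.mem_univ i) (by rw [hi, hdiag])

end AlternatingDet

/-- The involution of `Fin (2 * n)` exchanging the two halves. -/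
def swapHalves (n : ℕ) (b : Fin (2 * n)) : Fin (2 * n) :=
  if h : (b : ℕ) < n then ⟨b + n, by omega⟩ else ⟨b - n, by omega⟩

lemma swapHalves_involutive (n : ℕ) : Function.Involutive (swapHalves n) := by
  intro b
  apply Fin.ext
  by_cases h : (b : ℕ) < n
  · simp [swapHalves, h]
  · have h' : (b : ℕ) - n < n := by omega
    simp [swapHalves, h, h']
    omega

lemma ent2n_eq (K : Type) [Field K] (n : ℕ) (v : K) (a b : Fin (2 * n)) :
    Ent2n K n v a b = if b = swapHalves n a then v else 0 := by
  unfold Ent2n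
  congr 1
  simp only [Fin.ext_iff, swapHalves, eq_iff_iff]
  split_ifs <;> simp <;> omega

section Kernel

variable {K : Type} [Field K] {n N : ℕ} {kk mm : Fin N → ℕ}
  {A : ∀ r : Fin N, Matrix (Fin (mm r)) (Fin (2 * n)) K}
  {e : ∀ r s : Fin N, Fin (kk r) → Fin (kk s) → K}

/-- A nonzero kernel vector of `Smat`, given block by block, forces the determinant to vanish. -/
lemma det_Smat_eq_zero_of_blocks (hediag : ∀ r i, e r r i i = 0)
    (u : ∀ p : Σ r : Fin N, Fin (kk r), Fin (mm p.1) → K)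
    (w : (Σ r : Fin N, Fin (kk r)) → Fin (2 * n) → K)
    (hw : ∀ p, A p.1 *ᵥ w p = 0)
    (hu : ∀ p b, ((A p.1)ᵀ *ᵥ u p) b +
      ∑ q : Σ r : Fin N, Fin (kk r), e p.1 q.1 p.2 q.2 * w q (swapHalves n b) = 0)
    (hne : ∃ p, u p ≠ 0 ∨ w p ≠ 0) :
    (Smat K N (2 * n) kk mm A e (Ent2n K n)).det = 0 := by
  rw [← Matrix.exists_mulVec_eq_zero_iff]
  refine ⟨fun x => Fin.addCases (u ⟨x.1, x.2.1⟩) (w ⟨x.1, x.2.1⟩) x.2.2, fun h0 => ?_, ?_⟩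
  · obtain ⟨⟨r, i⟩, h | h⟩ := hne
    · exact h (funext fun a => by simpa using congrFun h0 ⟨r, i, Fin.castAdd _ a⟩)
    · exact h (funext fun a => by simpa using congrFun h0 ⟨r, i, Fin.natAdd _ a⟩)
  · funext ⟨r, i, c⟩
    have hsum : ∀ f : (Σ r : Fin N, Fin (kk r) × Fin (mm r + 2 * n)) → K,
        ∑ y, f y = ∑ q : Σ r : Fin N, Fin (kk r),
          ((∑ a, f ⟨q.1, q.2, Fin.castAdd _ a⟩) + ∑ b, f ⟨q.1, q.2, Fin.natAdd _ b⟩) := fun f => by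
      simp only [Fintype.sum_sigma, Fintype.sum_prod_type, Fin.sum_univ_add]
    simp only [Matrix.mulVec, dotProduct, hsum, Fin.addCases_left, Fin.addCases_right,
      Pi.zero_apply]
    have hlt : ∀ r (a : Fin (mm r)), ¬ mm r ≤ (a : ℕ) := fun r a => a.2.not_ge
    refine Fin.addCases (fun a => ?_) (fun b => ?_) c
    · rw [Finset.sum_eq_single_of_mem ⟨r, i⟩ (Finset.mem_univ _)]
      · simpa [Smat, Anat, hlt, Matrix.mulVec, dotProduct] using congrFun (hw ⟨r, i⟩) a
      · intro q _ hq
        simp [Smat, hq.symm, hlt]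
    · rw [Finset.sum_add_distrib, ← hu ⟨r, i⟩ b]
      congr 1
      · rw [Finset.sum_eq_single_of_mem ⟨r, i⟩ (Finset.mem_univ _)]
        · simp [Smat, Anat, Matrix.mulVec, dotProduct, hlt]
        · intro q _ hq
          simp [Smat, hq.symm, hlt]
      · refine Finset.sum_congr rfl fun q _ => ?_
        by_cases hq : (⟨r, i⟩ : Σ r : Fin N, Fin (kk r)) = q
        · subst hq
          simp [Smat, hediag]
        · simp [Smat, hq, ent2n_eq]

lemma det_Smat_eq_zero_of_transpose_mulVec (hkk : ∀ r, 1 ≤ kk r)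
    (hediag : ∀ r i, e r r i i = 0) (r : Fin N) {y : Fin (mm r) → K} (hy : y ≠ 0)
    (h : (A r)ᵀ *ᵥ y = 0) :
    (Smat K N (2 * n) kk mm A e (Ent2n K n)).det = 0 := by
  let p₀ : Σ r : Fin N, Fin (kk r) := ⟨r, 0, hkk r⟩
  refine det_Smat_eq_zero_of_blocks hediag (Pi.single p₀ y) 0 (by simp) (fun p b => ?_)
    ⟨p₀, Or.inl (by simpa using hy)⟩
  by_cases hp : p = p₀
  · subst hp
    simpa using congrFun h b
  · simp [hp]

/-- The matrix `B` plays the role of `A (s + 1)`, or of the identity matrix when `s` is last. -/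
lemma det_Smat_eq_zero_of_rows [CharP K 2]
    (hesymm : ∀ r s i j, e r s i j = e s r j i) (hediag : ∀ r i, e r r i i = 0)
    {p : ℕ} (B : Matrix (Fin p) (Fin (2 * n)) K) (s : Fin N) (hp : mm s < p)
    (hodd : Odd (∑ r : {r // r ≤ s}, kk r))
    (hle : ∀ r ≤ s, ∀ x, A s *ᵥ x = 0 → A r *ᵥ x = 0)
    (hgt : ∀ r, s < r → ∀ y, ∃ u, (A r)ᵀ *ᵥ u = Bᵀ *ᵥ y)
    (hB : ∀ y, y ≠ 0 → Bᵀ *ᵥ y = 0 → (Smat K N (2 * n) kk mm A e (Ent2n K n)).det = 0) :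
    (Smat K N (2 * n) kk mm A e (Ent2n K n)).det = 0 := by
  obtain ⟨v, hv0, hv⟩ := Matrix.exists_mulVec_eq_zero_iff.2
    (Matrix.det_eq_zero_of_symm_of_odd_card
      (Matrix.of fun x y : Σ r : {r // r ≤ s}, Fin (kk r) => e x.1 y.1 x.2 y.2)
      (fun _ _ => hesymm ..) (fun _ => hediag ..) (by simpa using hodd))
  obtain ⟨y, hy, hy0⟩ : ∃ y : Fin p → K,
      A s *ᵥ (fun b => (Bᵀ *ᵥ y) (swapHalves n b)) = 0 ∧ y ≠ 0 := by
    let f := (A s).mulVecLin ∘ₗ LinearMap.funLeft K K (swapHalves n) ∘ₗ Bᵀ.mulVecLin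
    obtain ⟨y, hy, hy0⟩ := (Submodule.ne_bot_iff _).1
      (LinearMap.ker_ne_bot_of_finrank_lt (f := f) (by simpa using hp))
    exact ⟨y, hy, hy0⟩
  by_cases hz : Bᵀ *ᵥ y = 0
  · exact hB y hy0 hz
  set z := Bᵀ *ᵥ y with hzdef
  choose! U hU using hgt
  let V : (Σ r : Fin N, Fin (kk r)) → K := fun q => if h : q.1 ≤ s then v ⟨⟨q.1, h⟩, q.2⟩ else 0
  let c : (Σ r : Fin N, Fin (kk r)) → K := fun q => ∑ q' : Σ r : Fin N, Fin (kk r),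
    e q.1 q'.1 q.2 q'.2 * V q'
  have hc : ∀ q : Σ r : Fin N, Fin (kk r), q.1 ≤ s → c q = 0 := fun q hq => by
    refine Eq.trans ?_ (congrFun hv ⟨⟨q.1, hq⟩, q.2⟩)
    simp only [c, V, Matrix.mulVec, dotProduct, Fintype.sum_sigma, Matrix.of_apply]
    rw [← Fintype.sum_subtype_add_sum_subtype (· ≤ s)]
    refine (congrArg₂ _ (Fintype.sum_congr _ _ fun r => ?_)
      (Fintype.sum_eq_zero _ fun r => ?_)).trans (add_zero _)
    · simp [r.2]
    · simp [r.2]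
  refine det_Smat_eq_zero_of_blocks hediag
    (fun q => if q.1 ≤ s then 0 else -c q • U q.1 y)
    (fun q => V q • fun b => z (swapHalves n b)) (fun q => ?_) (fun q b => ?_) ?_
  · by_cases hq : q.1 ≤ s
    · rw [Matrix.mulVec_smul, hle _ hq _ hy, smul_zero]
    · simp [V, hq]
  · have hsum : ∑ q' : Σ r : Fin N, Fin (kk r), e q.1 q'.1 q.2 q'.2 *
        (V q' • fun b => z (swapHalves n b)) (swapHalves n b) = c q * z b := by
      simp only [c, Finset.sum_mul, Pi.smul_apply, smul_eq_mul, swapHalves_involutive n b,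
        mul_assoc]
    rw [hsum]
    by_cases hq : q.1 ≤ s
    · simp [hq, hc q hq]
    · simp [hq, Matrix.mulVec_smul, hU _ (not_le.1 hq), Matrix.mulVec_neg, ← hzdef]
  · obtain ⟨q, hq⟩ := Function.ne_iff.1 hv0
    obtain ⟨b, hb⟩ := Function.ne_iff.1 hz
    refine ⟨⟨q.1, q.2⟩, Or.inr (Function.ne_iff.2 ⟨swapHalves n b, ?_⟩)⟩
    simpa [V, swapHalves_involutive n b, q.1.2] using And.intro hq hb

end Kernel

lemma exists_transpose_mulVec_eq {R ι κ m : Type*} [CommRing R] [Fintype ι] [Fintype κ]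
    [DecidableEq κ] {M : Matrix ι m R} {M' : Matrix κ m R} (τ : ι → κ) (h : ∀ a, M a = M' (τ a))
    (y : ι → R) : ∃ u, M'ᵀ *ᵥ u = Mᵀ *ᵥ y := by
  refine ⟨∑ a, Pi.single (τ a) (y a), ?_⟩
  ext b
  rw [Matrix.mulVec_sum]
  simp [Matrix.mulVec, dotProduct, h, mul_comm]

/-- Proposition 2.2(1): `Γ = 2n`, all `m_r` even, and some `σ` with `k_σ` odd and
`m_σ < 2n`; then `det S = 0`. -/
theorem detS_case1
    (K : Type) [Field K] [CharP K 2]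
    (n N : ℕ) (hn : 0 < n) (hN : 0 < N)
    (kk mm : Fin N → ℕ)
    (hkk : ∀ r, 1 ≤ kk r) (hmm : ∀ r, 1 ≤ mm r ∧ mm r ≤ 2 * n)
    (A : ∀ r : Fin N, Matrix (Fin (mm r)) (Fin (2 * n)) K)
    (hA : ∀ r s : Fin N, r < s → mm r < mm s ∧
      ∃ τ : Fin (mm r) → Fin (mm s), Function.Injective τ ∧ ∀ a, A r a = A s (τ a))
    (e : ∀ r s : Fin N, Fin (kk r) → Fin (kk s) → K)
    (hesymm : ∀ r s i j, e r s i j = e s r j i)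
    (hediag : ∀ r i, e r r i i = 0)
    (heven : ∀ r, Even (mm r))
    (hsig : ∃ σ : Fin N, Odd (kk σ) ∧ mm σ < 2 * n) :
    (Smat K N (2 * n) kk mm A e (Ent2n K n)).det = 0 := by
  have hrow : ∀ r s : Fin N, r ≤ s → ∃ τ : Fin (mm r) → Fin (mm s), ∀ a, A r a = A s (τ a) := by
    intro r s h
    rcases h.eq_or_lt with rfl | h
    · exact ⟨id, fun _ => rfl⟩
    · obtain ⟨-, τ, -, hτ⟩ := hA r s h
      exact ⟨τ, hτ⟩
  obtain ⟨s, ⟨hs, hms⟩, hmin⟩ : ∃ s : Fin N, (Odd (kk s) ∧ mm s < 2 * n) ∧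
      ∀ r < s, ¬ (Odd (kk r) ∧ mm r < 2 * n) := by
    obtain ⟨s, hs, hmin⟩ := WellFounded.has_min (wellFounded_lt (α := Fin N)) _ hsig
    exact ⟨s, hs, fun r hr h => hmin r h hr⟩
  have hodd : Odd (∑ r : {r // r ≤ s}, kk r) := by
    rw [← Finset.add_sum_erase _ _ (Finset.mem_univ (⟨s, le_rfl⟩ : {r // r ≤ s}))]
    refine hs.add_even (Finset.even_sum _ fun r hr => ?_)
    have hlt : r.1 < s := lt_of_le_of_ne r.2 fun h => (Finset.mem_erase.1 hr).1 (Subtype.ext h)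
    exact Nat.not_odd_iff_even.1 fun h => hmin r hlt ⟨h, (hA r s hlt).1.trans hms⟩
  have hle : ∀ r ≤ s, ∀ x, A s *ᵥ x = 0 → A r *ᵥ x = 0 := fun r hr x hx => by
    obtain ⟨τ, hτ⟩ := hrow r s hr
    funext a
    simpa [Matrix.mulVec, hτ a] using congrFun hx (τ a)
  by_cases hlast : ∃ t, s < t
  · obtain ⟨t, hst, hmint⟩ := WellFounded.has_min (wellFounded_lt (α := Fin N)) _ hlast
    refine det_Smat_eq_zero_of_rows hesymm hediag (A t) s (hA s t hst).1 hodd hle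
      (fun r hr y => ?_) fun y => det_Smat_eq_zero_of_transpose_mulVec hkk hediag t
    obtain ⟨τ, hτ⟩ := hrow t r (not_lt.1 (hmint r hr))
    exact exists_transpose_mulVec_eq τ hτ y
  · exact det_Smat_eq_zero_of_rows hesymm hediag 1 s hms hodd hle
      (fun r hr => absurd ⟨r, hr⟩ hlast) fun y hy h => absurd (by simpa using h) hy
end

section
/- Assume Γ = 2n and assume there exists σ ∈ [1,N] with m_σ odd. Then det S = 0. -/
open Matrix

/-- An alternating matrix of odd size over a ring of characteristic two is singular. -/
theorem det_eq_zero_of_isSymm_of_odd_card {R ι : Type*} [CommRing R] [CharP R 2]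
    [Fintype ι] [DecidableEq ι] {M : Matrix ι ι R} (hM : M.IsSymm) (hdiag : ∀ i, M i i = 0)
    (hodd : Odd (Fintype.card ι)) : M.det = 0 := by
  rw [Matrix.det_apply']
  refine Finset.sum_involution (fun g _ => g⁻¹) ?_ ?_ (fun _ _ => Finset.mem_univ _)
    (fun g _ => inv_inv g)
  · intro g _
    have h : ∏ i, M (g⁻¹ i) i = ∏ i, M (g i) i := by
      rw [← Equiv.prod_comp g]
      exact Finset.prod_congr rfl fun i _ => by simpa using hM.apply (g i) i
    rw [h, Equiv.Perm.sign_inv]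
    exact CharTwo.add_self_eq_zero _
  · intro g _ hg hinv
    apply hg
    obtain ⟨i, hi⟩ : ∃ i, g i = i := by
      refine Equiv.Perm.exists_fixed_point_of_prime (p := 2) (n := 1)
        (fun h => (Nat.not_even_iff_odd.mpr hodd) (even_iff_two_dvd.mpr h)) ?_
      rw [pow_one, pow_two]
      nth_rewrite 1 [← hinv]
      exact inv_mul_cancel g
    rw [Finset.prod_eq_zero (Finset.mem_univ i) (by rw [hi, hdiag]), mul_zero]

section Smat

variable {K : Type} [Field K] {n N : ℕ} {kk mm : Fin N → ℕ}
  {A : ∀ r : Fin N, Matrix (Fin (mm r)) (Fin (2 * n)) K}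
  {e : ∀ r s : Fin N, Fin (kk r) → Fin (kk s) → K}

theorem Smat_castAdd_castAdd {r s : Fin N} (i : Fin (kk r)) (j : Fin (kk s))
    (a : Fin (mm r)) (b : Fin (mm s)) :
    Smat K N (2 * n) kk mm A e (Ent2n K n)
      ⟨r, i, Fin.castAdd (2 * n) a⟩ ⟨s, j, Fin.castAdd (2 * n) b⟩ = 0 := by
  simp [Smat, a.isLt.not_ge, b.isLt.not_ge]

theorem Smat_castAdd_natAdd {r s : Fin N} (i : Fin (kk r)) (j : Fin (kk s))
    (a : Fin (mm r)) (b : Fin (2 * n)) :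
    Smat K N (2 * n) kk mm A e (Ent2n K n)
      ⟨r, i, Fin.castAdd (2 * n) a⟩ ⟨s, j, Fin.natAdd (mm s) b⟩ =
      if (⟨r, i⟩ : Σ r, Fin (kk r)) = ⟨s, j⟩ then A r a b else 0 := by
  simp [Smat, Anat, a.isLt.not_ge]

theorem Smat_natAdd_castAdd {r s : Fin N} (i : Fin (kk r)) (j : Fin (kk s))
    (a : Fin (2 * n)) (b : Fin (mm s)) :
    Smat K N (2 * n) kk mm A e (Ent2n K n)
      ⟨r, i, Fin.natAdd (mm r) a⟩ ⟨s, j, Fin.castAdd (2 * n) b⟩ =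
      if (⟨r, i⟩ : Σ r, Fin (kk r)) = ⟨s, j⟩ then A s b a else 0 := by
  simp [Smat, Anat, b.isLt.not_ge]

theorem Smat_natAdd_natAdd (hediag : ∀ r i, e r r i i = 0)
    {r s : Fin N} (i : Fin (kk r)) (j : Fin (kk s)) (a b : Fin (2 * n)) :
    Smat K N (2 * n) kk mm A e (Ent2n K n)
      ⟨r, i, Fin.natAdd (mm r) a⟩ ⟨s, j, Fin.natAdd (mm s) b⟩ =
      e r s i j * Ent2n K n 1 a b := by
  by_cases h : (⟨r, i⟩ : Σ r, Fin (kk r)) = ⟨s, j⟩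
  · cases h
    simp [Smat, hediag]
  · simp only [Smat, Matrix.of_apply, if_neg h]
    simp [Ent2n]

/-- A nonzero solution of the block equations of `S` makes `S` singular. -/
theorem det_Smat_eq_zero (hediag : ∀ r i, e r r i i = 0)
    (u : ∀ t : Σ r, Fin (kk r), Fin (mm t.1) → K)
    (w : (Σ r, Fin (kk r)) → Fin (2 * n) → K)
    (hne : (∃ t a, u t a ≠ 0) ∨ ∃ t b, w t b ≠ 0)
    (hw : ∀ t, A t.1 *ᵥ w t = 0)
    (hu : ∀ t a, ∑ b, A t.1 b a * u t b +
      ∑ t', e t.1 t'.1 t.2 t'.2 * ∑ b : Fin (2 * n), Ent2n K n 1 a b * w t' b = 0) :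
    (Smat K N (2 * n) kk mm A e (Ent2n K n)).det = 0 := by
  rw [← Matrix.exists_mulVec_eq_zero_iff]
  refine ⟨fun x => Fin.addCases (u ⟨x.1, x.2.1⟩) (w ⟨x.1, x.2.1⟩) x.2.2, ?_, ?_⟩
  · intro h0
    rcases hne with ⟨t, a, h⟩ | ⟨t, b, h⟩
    · exact h (by simpa using congrFun h0 ⟨t.1, t.2, Fin.castAdd _ a⟩)
    · exact h (by simpa using congrFun h0 ⟨t.1, t.2, Fin.natAdd _ b⟩)
  · ext ⟨s, j, q⟩
    have key : ∀ f : (Σ r : Fin N, Fin (kk r) × Fin (mm r + 2 * n)) → K,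
        ∑ x, f x = ∑ t : Σ r, Fin (kk r), (∑ b, f ⟨t.1, t.2, Fin.castAdd _ b⟩ +
          ∑ b, f ⟨t.1, t.2, Fin.natAdd _ b⟩) := fun f => by
      simp only [Fintype.sum_sigma, Fintype.sum_prod_type, Fin.sum_univ_add]
    simp only [Matrix.mulVec, dotProduct, Pi.zero_apply]
    rw [key]
    induction q using Fin.addCases with
    | left a =>
      simp only [Smat_castAdd_castAdd, Smat_castAdd_natAdd, Fin.addCases_right, zero_mul,
        Finset.sum_const_zero, zero_add, ite_mul, Sigma.eta]
      rw [Finset.sum_comm]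
      simpa [Matrix.mulVec, dotProduct] using congrFun (hw ⟨s, j⟩) a
    | right a =>
      simp only [Smat_natAdd_castAdd, Smat_natAdd_natAdd hediag, Fin.addCases_left,
        Fin.addCases_right, Sigma.eta, Finset.sum_add_distrib, ite_mul, zero_mul, mul_assoc,
        ← Finset.mul_sum]
      refine Eq.trans ?_ (hu ⟨s, j⟩ a)
      congr 1
      rw [Finset.sum_eq_single (⟨s, j⟩ : Σ r, Fin (kk r))]
      · simp
      · intro t _ ht
        simp [ht.symm]
      · simp

end Smat

/-- A linear system indexed by `r < σ` with unknowns indexed by `r ≤ σ` has a nonzero solution. -/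
theorem exists_ne_zero_of_sigma_le {K : Type*} [Field K] {N : ℕ} {kk : Fin N → ℕ} (σ : Fin N)
    (hσ : 1 ≤ kk σ) (E : (Σ r, Fin (kk r)) → (Σ r, Fin (kk r)) → K) :
    ∃ c : (Σ r, Fin (kk r)) → K, c ≠ 0 ∧ (∀ t, σ < t.1 → c t = 0) ∧
      ∀ t, t.1 < σ → ∑ t', E t t' * c t' = 0 := by
  let M : Matrix {t : Σ r, Fin (kk r) // t.1 < σ} {t : Σ r, Fin (kk r) // t.1 ≤ σ} K :=
    Matrix.of fun t t' => E t t'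
  have hcard : Fintype.card {t : Σ r, Fin (kk r) // t.1 < σ} <
      Fintype.card {t : Σ r, Fin (kk r) // t.1 ≤ σ} :=
    Fintype.card_lt_of_injective_of_notMem (fun t => ⟨t.1, t.2.le⟩)
      (fun t t' h => Subtype.ext (congrArg (fun x => x.1) h)) (b := ⟨⟨σ, ⟨0, hσ⟩⟩, le_rfl⟩)
      (by
        rintro ⟨t, h⟩
        have h1 := congrArg (fun x => x.1.1) h
        exact t.2.ne h1)
  obtain ⟨c, hc, hc0⟩ := Submodule.exists_mem_ne_zero_of_ne_bot
    (LinearMap.ker_ne_bot_of_finrank_lt (f := M.mulVecLin) (by simpa using hcard))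
  refine ⟨fun t => if h : t.1 ≤ σ then c ⟨t, h⟩ else 0, ?_, ?_, ?_⟩
  · intro h
    exact hc0 (funext fun t => by simpa [t.2] using congrFun h t.1)
  · intro t ht
    simp [ht.not_ge]
  · intro t ht
    have h := congrFun (LinearMap.mem_ker.mp hc) ⟨t, ht⟩
    simp only [Matrix.mulVecLin_apply, Matrix.mulVec, dotProduct, M, Matrix.of_apply,
      Pi.zero_apply] at h
    refine Eq.trans (Eq.symm ?_) h
    refine (Finset.sum_of_injOn Subtype.val Subtype.val_injective.injOn (by simp) ?_ ?_)
    · intro t' _ ht'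
      beta_reduce
      rw [dif_neg (fun h => ht' ⟨⟨t', h⟩, by simp, rfl⟩), mul_zero]
    · intro t' _
      beta_reduce
      rw [dif_pos t'.2]

/-- An odd-sized bordered symplectic matrix in characteristic two has a nontrivial kernel. -/
theorem exists_bordered_kernel {K : Type} [Field K] [CharP K 2] {n m : ℕ} (hn : 0 < n)
    (hm : Odd m) (A : Matrix (Fin m) (Fin (2 * n)) K) :
    ∃ (y : Fin m → K) (v : Fin (2 * n) → K), (y ≠ 0 ∨ v ≠ 0) ∧ A *ᵥ v = 0 ∧
      ∀ a, ∑ b, A b a * y b + ∑ b : Fin (2 * n), Ent2n K n 1 a b * v b = 0 := by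
  have hdet : (Matrix.fromBlocks 0 A Aᵀ
      (Matrix.of fun a b : Fin (2 * n) => Ent2n K n 1 a b)).det = 0 := by
    apply det_eq_zero_of_isSymm_of_odd_card
    · refine Matrix.IsSymm.fromBlocks (by simp) rfl ?_
      ext a b
      simp [Ent2n, or_comm]
    · rintro (i | i)
      · simp
      · simp [Ent2n, hn.ne']
    · simpa [Nat.odd_add, parity_simps] using hm
  obtain ⟨x, hx, h⟩ := Matrix.exists_mulVec_eq_zero_iff.mpr hdet
  rw [Matrix.fromBlocks_mulVec] at h
  refine ⟨x ∘ Sum.inl, x ∘ Sum.inr, ?_, ?_, fun a => ?_⟩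
  · by_contra! h0
    exact hx (funext fun i => by
      rcases i with i | i
      · exact congrFun h0.1 i
      · exact congrFun h0.2 i)
  · ext a
    simpa using congrFun h (Sum.inl a)
  · simpa [Matrix.mulVec, dotProduct] using congrFun h (Sum.inr a)

/-- Proposition 2.2(2): `Γ = 2n` and some `σ` with `m_σ` odd; then `det S = 0`. -/
theorem detS_case2
    (K : Type) [Field K] [CharP K 2]
    (n N : ℕ) (hn : 0 < n) (hN : 0 < N)
    (kk mm : Fin N → ℕ)
    (hkk : ∀ r, 1 ≤ kk r) (hmm : ∀ r, 1 ≤ mm r ∧ mm r ≤ 2 * n)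
    (A : ∀ r : Fin N, Matrix (Fin (mm r)) (Fin (2 * n)) K)
    (hA : ∀ r s : Fin N, r < s → mm r < mm s ∧
      ∃ τ : Fin (mm r) → Fin (mm s), Function.Injective τ ∧ ∀ a, A r a = A s (τ a))
    (e : ∀ r s : Fin N, Fin (kk r) → Fin (kk s) → K)
    (hesymm : ∀ r s i j, e r s i j = e s r j i)
    (hediag : ∀ r i, e r r i i = 0)
    (hsig : ∃ σ : Fin N, Odd (mm σ)) :
    (Smat K N (2 * n) kk mm A e (Ent2n K n)).det = 0 := by
  obtain ⟨σ, hσ⟩ := hsig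
  have hτ : ∀ r s : Fin N, r ≤ s → ∃ τ : Fin (mm r) → Fin (mm s), ∀ a, A r a = A s (τ a) := by
    intro r s hrs
    rcases hrs.eq_or_lt with rfl | hlt
    · exact ⟨id, fun _ => rfl⟩
    · obtain ⟨-, τ, -, h⟩ := hA r s hlt
      exact ⟨τ, h⟩
  obtain ⟨y, v, hne, hAv, hyv⟩ := exists_bordered_kernel hn hσ (A σ)
  by_cases hv : v = 0
  · subst hv
    have hy : y ≠ 0 := hne.resolve_right (by simp)
    obtain ⟨b₀, hb₀⟩ := Function.ne_iff.mp hy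
    refine det_Smat_eq_zero hediag (Pi.single ⟨σ, ⟨0, hkk σ⟩⟩ y) 0
      (Or.inl ⟨⟨σ, ⟨0, hkk σ⟩⟩, b₀, by simpa using hb₀⟩) (fun t => by simp) (fun t a => ?_)
    by_cases ht : t = ⟨σ, ⟨0, hkk σ⟩⟩
    · subst ht
      simpa using hyv a
    · simp [Pi.single_eq_of_ne ht]
  · have hpush : ∀ s, ∃ z : Fin (mm s) → K, σ ≤ s →
        ∀ a, ∑ b, A s b a * z b = ∑ b, A σ b a * y b := by
      intro s
      by_cases hs : σ ≤ s
      · obtain ⟨τ, h⟩ := hτ σ s hs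
        refine ⟨fun b => ∑ b', if τ b' = b then y b' else 0, fun _ a => ?_⟩
        simp only [Finset.mul_sum, mul_ite, mul_zero]
        rw [Finset.sum_comm]
        simp [h]
      · exact ⟨0, fun h => absurd h hs⟩
    choose z hz using hpush
    obtain ⟨c, hc, hc_gt, hc_lt⟩ := exists_ne_zero_of_sigma_le σ (hkk σ)
      (fun t t' => e t.1 t'.1 t.2 t'.2)
    obtain ⟨t₀, ht₀⟩ := Function.ne_iff.mp hc
    obtain ⟨b₀, hb₀⟩ := Function.ne_iff.mp hv
    refine det_Smat_eq_zero hediag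
      (fun t => (∑ t', e t.1 t'.1 t.2 t'.2 * c t') • z t.1) (fun t => c t • v)
      (Or.inr ⟨t₀, b₀, mul_ne_zero ht₀ hb₀⟩) (fun t => ?_) (fun t a => ?_)
    · rcases le_or_gt t.1 σ with h | h
      · obtain ⟨τ, h⟩ := hτ t.1 σ h
        have : A t.1 *ᵥ v = 0 := by
          ext a
          simpa [Matrix.mulVec, h a] using congrFun hAv (τ a)
        rw [Matrix.mulVec_smul, this, smul_zero]
      · rw [hc_gt t h, zero_smul, Matrix.mulVec_zero]
    · have hfactor : ∑ b, A t.1 b a * ((∑ t', e t.1 t'.1 t.2 t'.2 * c t') • z t.1) b +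
          ∑ t', e t.1 t'.1 t.2 t'.2 * ∑ b : Fin (2 * n), Ent2n K n 1 a b * (c t' • v) b =
          (∑ t', e t.1 t'.1 t.2 t'.2 * c t') *
            (∑ b, A t.1 b a * z t.1 b + ∑ b : Fin (2 * n), Ent2n K n 1 a b * v b) := by
        rw [mul_add, Finset.sum_mul _ _ (∑ b : Fin (2 * n), Ent2n K n 1 a b * v b),
          Finset.mul_sum]
        congr 1
        · exact Finset.sum_congr rfl fun b _ => mul_left_comm _ _ _
        · refine Finset.sum_congr rfl fun t' _ => ?_
          rw [mul_assoc, Finset.mul_sum _ _ (c t')]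
          congr 1
          exact Finset.sum_congr rfl fun b _ => mul_left_comm _ _ _
      rw [hfactor]
      rcases lt_or_ge t.1 σ with h | h
      · rw [hc_lt t h, zero_mul]
      · rw [hz t.1 h, hyv a, mul_zero]
end
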